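/- Let Ω be a measurable space and μ a probability measure on Ω × Bool, with λ, ν, η, and the Bayes classifier g* defined as usual. Let ηₙ : Ω → ℝ be any measurable function, and define the plug-in classifier gₙ : Ω → Bool by gₙ(x) = true if and only if ηₙ(x) ≥ 1/2. Then μ{(x,y) : gₙ(x) ≠ y} − μ{(x,y) : g*(x) ≠ y} ≤ 2 √(∫ (η(x) − ηₙ(x))² dλ(x)). -/

import Mathlib

open MeasureTheory

lemma plugin_err_eq {Ω : Type*} [MeasurableSpace Ω]
    (μ : Measure (Ω × Bool)) [IsProbabilityMeasure μ]
    (lam : Measure Ω) [IsProbabilityMeasure lam] (hlam : lam = μ.map Prod.fst)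
    (ν : Measure Ω) [IsFiniteMeasure ν]
    (hν : ∀ A : Set Ω, MeasurableSet A → ν A = μ (A ×ˢ ({true} : Set Bool)))
    (hle : ν ≤ lam) (h1 : ∀ᵐ x ∂lam, ν.rnDeriv lam x ≤ 1)
    (g : Ω → Bool) (hg : Measurable g) :
    μ {p : Ω × Bool | g p.1 ≠ p.2}
      = ∫⁻ x, (if g x = true then 1 - ν.rnDeriv lam x else ν.rnDeriv lam x) ∂lam := by
  have hac : ν ≪ lam := Measure.absolutelyContinuous_of_le hle
  have hA : MeasurableSet {x | g x = true} := hg (measurableSet_singleton true)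
  have hr : Measurable (ν.rnDeriv lam) := Measure.measurable_rnDeriv _ _
  have hset : ∀ B : Set Ω, ∫⁻ x in B, ν.rnDeriv lam x ∂lam = ν B :=
    fun B => Measure.setLIntegral_rnDeriv hac B
  have hfalse : ∀ A : Set Ω, MeasurableSet A →
      μ (A ×ˢ ({false} : Set Bool)) = lam A - ν A := by
    intro A hA
    have : lam A = μ (A ×ˢ ({false} : Set Bool)) + ν A := by
      rw [hν A hA, hlam, Measure.map_apply measurable_fst hA,
        ← measure_union _ (hA.prod (measurableSet_singleton true))]
      · congr 1
        ext ⟨x, b⟩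
        cases b <;> simp
      · rw [Set.disjoint_left]
        rintro ⟨x, b⟩ h h'
        cases b <;> simp_all
    rw [this, ENNReal.add_sub_cancel_right (measure_ne_top _ _)]
  have hsplit : {p : Ω × Bool | g p.1 ≠ p.2}
      = ({x | g x = true} ×ˢ ({false} : Set Bool)) ∪
        ({x | g x = true}ᶜ ×ˢ ({true} : Set Bool)) := by
    ext ⟨x, b⟩
    cases b <;> simp
  rw [hsplit, measure_union _ (hA.compl.prod (measurableSet_singleton true)),
    hfalse _ hA, ← hν _ hA.compl, ← lintegral_add_compl _ hA]
  · congr 1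
    · rw [setLIntegral_congr_fun hA (f := fun x => if g x = true then 1 - ν.rnDeriv lam x else ν.rnDeriv lam x)
        (g := fun x => 1 - ν.rnDeriv lam x)
        (fun x hx => if_pos hx), lintegral_sub hr]
      · simp [hset]
      · rw [hset]; exact measure_ne_top _ _
      · exact ae_restrict_of_ae h1
    · rw [setLIntegral_congr_fun hA.compl (f := fun x => if g x = true then 1 - ν.rnDeriv lam x else ν.rnDeriv lam x)
        (g := fun x => ν.rnDeriv lam x)
        (fun x hx => if_neg hx), hset]
  · rw [Set.disjoint_left]
    rintro ⟨x, b⟩ h h'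
    cases b <;> simp_all

/-- The excess misclassification error of a plug-in classifier `gₙ` built from an
estimate `ηₙ` of the regression function `η` is at most `2 √(∫ (η - ηₙ)² dλ)`. -/
theorem plugin_classifier_L2_bound
    {Ω : Type*} [MeasurableSpace Ω]
    (μ : Measure (Ω × Bool)) [IsProbabilityMeasure μ]
    (lam : Measure Ω) (hlam : lam = μ.map Prod.fst)
    (ν : Measure Ω)
    (hν : ∀ A : Set Ω, MeasurableSet A → ν A = μ (A ×ˢ ({true} : Set Bool)))
    (η : Ω → ℝ) (hη : ∀ x, η x = (ν.rnDeriv lam x).toReal)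
    (gstar : Ω → Bool) (hgstar : ∀ x, gstar x = true ↔ (1/2 : ℝ) ≤ η x)
    (ηn : Ω → ℝ) (hηn : Measurable ηn)
    (gn : Ω → Bool) (hgn : ∀ x, gn x = true ↔ (1/2 : ℝ) ≤ ηn x) :
    μ {p : Ω × Bool | gn p.1 ≠ p.2} - μ {p : Ω × Bool | gstar p.1 ≠ p.2}
      ≤ 2 * (∫⁻ x, ENNReal.ofReal ((η x - ηn x) ^ 2) ∂lam) ^ ((1 : ℝ) / 2) := by
  have : IsProbabilityMeasure lam := by
    rw [hlam]; exact Measure.isProbabilityMeasure_map measurable_fst.aemeasurable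
  have hle : ν ≤ lam := by
    refine Measure.le_iff.2 fun A hA => ?_
    rw [hν A hA, hlam, Measure.map_apply measurable_fst hA]
    exact measure_mono fun p hp => hp.1
  have : IsFiniteMeasure ν := isFiniteMeasure_of_le lam hle
  have h1 : ∀ᵐ x ∂lam, ν.rnDeriv lam x ≤ 1 := Measure.rnDeriv_le_one_of_le hle
  have hηm : Measurable η := by
    have : η = fun x => (ν.rnDeriv lam x).toReal := funext hη
    rw [this]; exact (Measure.measurable_rnDeriv _ _).ennreal_toReal
  have hmg : ∀ (f : Ω → ℝ) (g : Ω → Bool), Measurable f →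
      (∀ x, g x = true ↔ (1/2 : ℝ) ≤ f x) → Measurable g := by
    intro f g hf h
    refine measurable_to_bool ?_
    have : g ⁻¹' {true} = {x | (1/2 : ℝ) ≤ f x} := by ext x; simp [h]
    rw [this]; exact measurableSet_le measurable_const hf
  rw [plugin_err_eq μ lam hlam ν hν hle h1 gn (hmg _ _ hηn hgn),
    plugin_err_eq μ lam hlam ν hν hle h1 gstar (hmg _ _ hηm hgstar), tsub_le_iff_left]
  have hd : Measurable fun x => ENNReal.ofReal |η x - ηn x| :=
    ((hηm.sub hηn).abs).ennreal_ofReal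
  have hL : ∫⁻ x, ENNReal.ofReal |η x - ηn x| ∂lam
      ≤ (∫⁻ x, ENNReal.ofReal ((η x - ηn x) ^ 2) ∂lam) ^ ((1 : ℝ) / 2) := by
    have := ENNReal.lintegral_mul_le_Lp_mul_Lq lam Real.HolderConjugate.two_two
      hd.aemeasurable (aemeasurable_const (b := (1 : ENNReal)))
    simp only [Pi.mul_apply, mul_one, ENNReal.one_rpow, lintegral_const, measure_univ] at this
    refine this.trans (le_of_eq ?_)
    congr 2
    ext x
    rw [ENNReal.ofReal_rpow_of_nonneg (abs_nonneg _) (by norm_num)]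
    simp
  refine le_trans ?_ (add_le_add_right (mul_le_mul_right hL 2) _)
  rw [← lintegral_const_mul _ hd, ← lintegral_add_right _ (hd.const_mul _)]
  refine lintegral_mono_ae ?_
  filter_upwards [h1] with x hx
  have hr : ν.rnDeriv lam x = ENNReal.ofReal (η x) := by
    rw [hη, ENNReal.ofReal_toReal (ne_top_of_le_ne_top ENNReal.one_ne_top hx)]
  have h0 : 0 ≤ η x := by rw [hη]; exact ENNReal.toReal_nonneg
  have hη1 : η x ≤ 1 := by rw [hr] at hx; exact ENNReal.ofReal_le_one.1 hx
  have h2 : (2 : ENNReal) = ENNReal.ofReal 2 := by simp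
  have hs : (1 : ENNReal) - ENNReal.ofReal (η x) = ENNReal.ofReal (1 - η x) := by
    rw [ENNReal.ofReal_sub _ h0, ENNReal.ofReal_one]
  rw [hr, hs, h2, ← ENNReal.ofReal_mul (by norm_num)]
  have a1 := le_abs_self (η x - ηn x)
  have a2 := neg_abs_le (η x - ηn x)
  by_cases hA : (1/2 : ℝ) ≤ ηn x <;> by_cases hB : (1/2 : ℝ) ≤ η x <;>
    simp only [hgn, hgstar, hA, hB, if_true, if_false] <;>
    rw [← ENNReal.ofReal_add (by linarith) (by positivity)] <;>
    apply ENNReal.ofReal_le_ofReal <;> linarith
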